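/- Let (p, x, σ, β) be admissible parameters with z = p − Σ_{i=1}^{n−1} x_i²/σ_i > 0, and let ∇ be the Levi-Civita product of the inner product S(p, x, σ, β) on 𝔠𝔥(n). Then (with σ_{n−1} = 1 and indices i, j ∈ {1,…,n−1}): ∇_X X = (1/(2z))(Σ_i (x_i²/σ_i)·X − p·Σ_i (x_i/σ_i)·Y_i); ∇_X Y_i = (x_i/(2z))(X − Σ_k (x_k/σ_k)·Y_k); ∇_{Y_i} X = (x_i/(2z))(X − Σ_k (x_k/σ_k)·Y_k) − (1/2)Y_i; ∇_{Y_i} Y_j = (δ_{ij}σ_i/(2z))(X − Σ_k (x_k/σ_k)·Y_k); ∇_{Y_i} Z_j = −(δ_{ij}/2)W = −∇_{Z_j} Y_i; ∇_{Y_i} W = (β/(2σ_i))Z_i = ∇_W Y_i; ∇_{Z_i} X = −(1/2)Z_i; ∇_{Z_i} Z_j = (δ_{ij}σ_i/(2z))(X − Σ_k (x_k/σ_k)·Y_k); ∇_W W = (β/z)(X − Σ_i (x_i/σ_i)·Y_i); ∇_W X = −W; ∇_W Z_i = (β/(2zσ_i))(x_i·X − x_i·Σ_k (x_k/σ_k)·Y_k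 − z·Y_i) = ∇_{Z_i} W; and ∇_X Z_i = ∇_X W = 0. -/

import Mathlib

noncomputable section

open Matrix BigOperators Finset

namespace CHn

/-- Structure constants of the Lie algebra 𝔠𝔥(n) in the ordered basis
`(X, Y_1, …, Y_{n-1}, Z_1, …, Z_{n-1}, W)`:
index `0 ↦ X`, indices `1,…,n-1 ↦ Y_1,…,Y_{n-1}`,
indices `n,…,2n-2 ↦ Z_1,…,Z_{n-1}`, index `2n-1 ↦ W`.
The nonzero brackets are `[X,Y_i] = (1/2)Y_i`, `[X,Z_i] = (1/2)Z_i`,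
`[X,W] = W`, `[Z_j,Y_i] = δ_{ij} W`. -/
def structC (n : ℕ) (i j k : Fin (2 * n)) : ℝ :=
  (if i.val = 0 ∧ j = k ∧ 1 ≤ j.val ∧ j.val ≤ 2 * n - 2 then (1 : ℝ) / 2 else 0)
  - (if j.val = 0 ∧ i = k ∧ 1 ≤ i.val ∧ i.val ≤ 2 * n - 2 then (1 : ℝ) / 2 else 0)
  + (if i.val = 0 ∧ j.val = 2 * n - 1 ∧ k.val = 2 * n - 1 then (1 : ℝ) else 0)
  - (if j.val = 0 ∧ i.val = 2 * n - 1 ∧ k.val = 2 * n - 1 then (1 : ℝ) else 0)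
  + (if n ≤ i.val ∧ i.val ≤ 2 * n - 2 ∧ i.val = j.val + (n - 1) ∧ k.val = 2 * n - 1
      then (1 : ℝ) else 0)
  - (if n ≤ j.val ∧ j.val ≤ 2 * n - 2 ∧ j.val = i.val + (n - 1) ∧ k.val = 2 * n - 1
      then (1 : ℝ) else 0)

/-- The Lie bracket of `𝔠𝔥(n)`, as a bilinear operation on coordinate vectors. -/
def bracket (n : ℕ) (u v : Fin (2 * n) → ℝ) : Fin (2 * n) → ℝ :=
  fun k => ∑ i, ∑ j, u i * v j * structC n i j k

/-- `F` is the matrix (in the ordered basis) of a Lie algebra automorphism of `𝔠𝔥(n)`. -/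
def IsAut (n : ℕ) (F : Matrix (Fin (2 * n)) (Fin (2 * n)) ℝ) : Prop :=
  IsUnit F ∧ ∀ u v, F.mulVec (bracket n u v) = bracket n (F.mulVec u) (F.mulVec v)

/-- The normal form `S(p, x, σ, β)`: the block matrix
`[[p, xᵀ, 0, 0], [x, σ, 0, 0], [0, 0, σ, 0], [0, 0, 0, β]]`
with blocks of sizes `1, n-1, n-1, 1`. -/
def Sform (n : ℕ) (p : ℝ) (x σ : Fin (n - 1) → ℝ) (β : ℝ) :
    Matrix (Fin (2 * n)) (Fin (2 * n)) ℝ := fun i j =>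
  if i.val = 0 ∧ j.val = 0 then p
  else if h : i.val = 0 ∧ 1 ≤ j.val ∧ j.val ≤ n - 1 then x ⟨j.val - 1, by omega⟩
  else if h : j.val = 0 ∧ 1 ≤ i.val ∧ i.val ≤ n - 1 then x ⟨i.val - 1, by omega⟩
  else if h : i = j ∧ 1 ≤ i.val ∧ i.val ≤ n - 1 then σ ⟨i.val - 1, by omega⟩
  else if h : i = j ∧ n ≤ i.val ∧ i.val ≤ 2 * n - 2 then σ ⟨i.val - n, by omega⟩
  else if i = j ∧ i.val = 2 * n - 1 then β
  else 0

/-- Admissibility of the parameters `(p, x, σ, β)`: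
`p, β > 0`, all `x_i ≥ 0`, `σ_1 ≥ … ≥ σ_{n-2} ≥ 1` and the convention `σ_{n-1} = 1`. -/
def Admissible (n : ℕ) (p : ℝ) (x σ : Fin (n - 1) → ℝ) (β : ℝ) : Prop :=
  0 < p ∧ 0 < β ∧ (∀ i, 0 ≤ x i) ∧ Antitone σ ∧ (∀ i, 1 ≤ σ i) ∧
    ∀ _h : 1 ≤ n - 1, σ ⟨n - 2, by omega⟩ = 1

/-- `z = p - Σ_i x_i² / σ_i`. -/
def zval (n : ℕ) (p : ℝ) (x σ : Fin (n - 1) → ℝ) : ℝ :=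
  p - ∑ i, (x i) ^ 2 / σ i

/-- The inner product on `𝔠𝔥(n)` determined by a matrix `S`. -/
def ip (n : ℕ) (S : Matrix (Fin (2 * n)) (Fin (2 * n)) ℝ) (u v : Fin (2 * n) → ℝ) : ℝ :=
  u ⬝ᵥ S.mulVec v

/-- The coordinates (w.r.t. the standard basis) of the Koszul form
`K(u,v)(T) = ⟨[u,v],T⟩ - ⟨[v,T],u⟩ + ⟨[T,u],v⟩`. -/
def koszul (n : ℕ) (S : Matrix (Fin (2 * n)) (Fin (2 * n)) ℝ)
    (u v : Fin (2 * n) → ℝ) : Fin (2 * n) → ℝ := fun t =>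
  ip n S (bracket n u v) (Pi.single t 1) - ip n S (bracket n v (Pi.single t 1)) u
    + ip n S (bracket n (Pi.single t 1) u) v

/-- The Levi-Civita product `∇_u v` of the inner product `S`,
i.e. the unique solution of the Koszul formula `2⟨∇_u v, T⟩ = K(u,v)(T)`
(for invertible symmetric `S`). -/
def nabla (n : ℕ) (S : Matrix (Fin (2 * n)) (Fin (2 * n)) ℝ)
    (u v : Fin (2 * n) → ℝ) : Fin (2 * n) → ℝ :=
  (2 : ℝ)⁻¹ • (S⁻¹).mulVec (koszul n S u v)

/-- The curvature operator `R(u,v)w = ∇_u∇_v w - ∇_v∇_u w - ∇_{[u,v]} w`. -/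
def curv (n : ℕ) (S : Matrix (Fin (2 * n)) (Fin (2 * n)) ℝ)
    (u v w : Fin (2 * n) → ℝ) : Fin (2 * n) → ℝ :=
  nabla n S u (nabla n S v w) - nabla n S v (nabla n S u w) - nabla n S (bracket n u v) w

/-- The Ricci form `Ric(u,v) = tr (T ↦ R(T,u)v)`. -/
def ricci (n : ℕ) (S : Matrix (Fin (2 * n)) (Fin (2 * n)) ℝ)
    (u v : Fin (2 * n) → ℝ) : ℝ :=
  ∑ t, curv n S (Pi.single t 1) u v t

/-- The scalar curvature `τ = Σ_{i,j} g^{ij} Ric(e_i, e_j)`. -/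
def scalarCurv (n : ℕ) (S : Matrix (Fin (2 * n)) (Fin (2 * n)) ℝ) : ℝ :=
  ∑ i, ∑ j, (S⁻¹) i j * ricci n S (Pi.single i 1) (Pi.single j 1)

/-- The wedge endomorphism `(u∧v)(w) = ⟨v,w⟩u - ⟨u,w⟩v`. -/
def wedge (n : ℕ) (S : Matrix (Fin (2 * n)) (Fin (2 * n)) ℝ)
    (u v : Fin (2 * n) → ℝ) : (Fin (2 * n) → ℝ) → (Fin (2 * n) → ℝ) :=
  fun w => ip n S v w • u - ip n S u w • v

/-- The standard symplectic matrix `J_m = [[0, I_m], [-I_m, 0]]`. -/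
def Jmat (m : ℕ) : Matrix (Fin (2 * m)) (Fin (2 * m)) ℝ := fun i j =>
  if j.val = i.val + m then 1 else if i.val = j.val + m then -1 else 0

/-- The block matrix `[[1, 0, 0], [u, M, 0], [a, vᵀ, λ]]`
with blocks of sizes `1, 2n-2, 1`. -/
def blockF (n : ℕ) (M : Matrix (Fin (2 * (n - 1))) (Fin (2 * (n - 1))) ℝ)
    (u v : Fin (2 * (n - 1)) → ℝ) (a lam : ℝ) :
    Matrix (Fin (2 * n)) (Fin (2 * n)) ℝ := fun i j =>
  if i.val = 0 then (if j.val = 0 then 1 else 0)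
  else if h : 1 ≤ i.val ∧ i.val ≤ 2 * n - 2 then
    (if j.val = 0 then u ⟨i.val - 1, by omega⟩
     else if h2 : 1 ≤ j.val ∧ j.val ≤ 2 * n - 2 then
       M ⟨i.val - 1, by omega⟩ ⟨j.val - 1, by omega⟩
     else 0)
  else
    (if j.val = 0 then a
     else if h2 : 1 ≤ j.val ∧ j.val ≤ 2 * n - 2 then v ⟨j.val - 1, by omega⟩
     else lam)

/-- The metric is Einstein: the Ricci form is proportional to the inner product. -/
def IsEinstein (n : ℕ) (S : Matrix (Fin (2 * n)) (Fin (2 * n)) ℝ) : Prop :=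
  ∃ c : ℝ, ∀ u v, ricci n S u v = c * ip n S u v

end CHn

namespace CHn

set_option linter.unreachableTactic false
set_option linter.unusedTactic false
set_option linter.unusedSimpArgs false
set_option linter.unusedVariables false
set_option linter.flexible false

theorem iX_lt (n : ℕ) (hn : 2 ≤ n) : 0 < 2 * n := by omega
theorem iY_lt (n : ℕ) (i : Fin (n - 1)) : i.val + 1 < 2 * n := by have := i.isLt; omega
theorem iZ_lt (n : ℕ) (i : Fin (n - 1)) : i.val + n < 2 * n := by have := i.isLt; omega
theorem iW_lt (n : ℕ) (hn : 2 ≤ n) : 2 * n - 1 < 2 * n := by omega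
/-- Index of `X`. -/
def iX (n : ℕ) (hn : 2 ≤ n) : Fin (2 * n) := ⟨0, iX_lt n hn⟩
/-- Index of `Y_i`. -/
def iY (n : ℕ) (i : Fin (n - 1)) : Fin (2 * n) := ⟨i.val + 1, iY_lt n i⟩
/-- Index of `Z_i`. -/
def iZ (n : ℕ) (i : Fin (n - 1)) : Fin (2 * n) := ⟨i.val + n, iZ_lt n i⟩
/-- Index of `W`. -/
def iW (n : ℕ) (hn : 2 ≤ n) : Fin (2 * n) := ⟨2 * n - 1, iW_lt n hn⟩
/-- Basis vector. -/
def E (n : ℕ) (t : Fin (2 * n)) : Fin (2 * n) → ℝ := Pi.single t 1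

theorem idx_cases (n : ℕ) (hn : 2 ≤ n) (t : Fin (2 * n)) :
    t = iX n hn ∨ (∃ i, t = iY n i) ∨ (∃ i, t = iZ n i) ∨ t = iW n hn := by
  have ht := t.isLt
  by_cases h0 : t.val = 0
  · left; exact Fin.ext h0
  by_cases h1 : t.val ≤ n - 1
  · right; left
    exact ⟨⟨t.val - 1, by omega⟩, Fin.ext (by simp only [iY]; omega)⟩
  by_cases h2 : t.val ≤ 2 * n - 2
  · right; right; left
    exact ⟨⟨t.val - n, by omega⟩, Fin.ext (by simp only [iZ]; omega)⟩
  · right; right; right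
    exact Fin.ext (by simp only [iW]; omega)

theorem bracket_E (n : ℕ) (a b : Fin (2 * n)) :
    bracket n (E n a) (E n b) = fun k => structC n a b k := by
  funext k
  simp only [bracket, E, Pi.single_apply]
  rw [Finset.sum_eq_single a]
  · rw [Finset.sum_eq_single b]
    · simp
    · intro j _ hj; simp [hj]
    · simp
  · intro j _ hj; simp [hj]
  · simp

theorem br_anti (n : ℕ) (a b : Fin (2 * n)) :
    bracket n (E n a) (E n b) = - bracket n (E n b) (E n a) := by
  rw [bracket_E, bracket_E]; funext k
  simp only [structC, Pi.neg_apply]; ring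

section br
variable (n : ℕ) (hn : 2 ≤ n) (i j : Fin (n - 1))

theorem br_XX : bracket n (E n (iX n hn)) (E n (iX n hn)) = 0 := by
  rw [bracket_E]; funext k
  have : (iX n hn).val = 0 := rfl
  simp only [structC, E, Pi.smul_apply, Pi.zero_apply, Pi.single_apply, Fin.ext_iff, smul_eq_mul]
  split_ifs <;> first | omega | norm_num
theorem br_XY : bracket n (E n (iX n hn)) (E n (iY n i)) = (1 / 2 : ℝ) • E n (iY n i) := by
  rw [bracket_E]; funext k
  have := i.isLt
  have : (iX n hn).val = 0 := rfl
  have : (iY n i).val = i.val + 1 := rfl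
  simp only [structC, E, Pi.smul_apply, Pi.zero_apply, Pi.single_apply, Fin.ext_iff, smul_eq_mul]
  split_ifs <;> first | omega | norm_num
theorem br_XZ : bracket n (E n (iX n hn)) (E n (iZ n i)) = (1 / 2 : ℝ) • E n (iZ n i) := by
  rw [bracket_E]; funext k
  have := i.isLt
  have : (iX n hn).val = 0 := rfl
  have : (iZ n i).val = i.val + n := rfl
  simp only [structC, E, Pi.smul_apply, Pi.zero_apply, Pi.single_apply, Fin.ext_iff, smul_eq_mul]
  split_ifs <;> first | omega | norm_num
theorem br_XW : bracket n (E n (iX n hn)) (E n (iW n hn)) = E n (iW n hn) := by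
  rw [bracket_E]; funext k
  have : (iW n hn).val = 2 * n - 1 := rfl
  have : (iX n hn).val = 0 := rfl
  simp only [structC, E, Pi.smul_apply, Pi.zero_apply, Pi.single_apply, Fin.ext_iff, smul_eq_mul]
  split_ifs <;> first | omega | norm_num
theorem br_ZY : bracket n (E n (iZ n j)) (E n (iY n i))
    = (if i = j then (1 : ℝ) else 0) • E n (iW n hn) := by
  rw [bracket_E]; funext k
  have := i.isLt
  have := j.isLt
  have : (iW n hn).val = 2 * n - 1 := rfl
  have : (iY n i).val = i.val + 1 := rfl
  have : (iZ n j).val = j.val + n := rfl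
  simp only [structC, E, Pi.smul_apply, Pi.zero_apply, Pi.single_apply, Fin.ext_iff, smul_eq_mul]
  split_ifs <;> first | omega | norm_num
theorem br_YY : bracket n (E n (iY n i)) (E n (iY n j)) = 0 := by
  rw [bracket_E]; funext k
  have := i.isLt
  have := j.isLt
  have : (iY n i).val = i.val + 1 := rfl
  have : (iY n j).val = j.val + 1 := rfl
  simp only [structC, E, Pi.smul_apply, Pi.zero_apply, Pi.single_apply, Fin.ext_iff, smul_eq_mul]
  split_ifs <;> first | omega | norm_num
theorem br_ZZ : bracket n (E n (iZ n i)) (E n (iZ n j)) = 0 := by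
  rw [bracket_E]; funext k
  have := i.isLt
  have := j.isLt
  have : (iZ n i).val = i.val + n := rfl
  have : (iZ n j).val = j.val + n := rfl
  simp only [structC, E, Pi.smul_apply, Pi.zero_apply, Pi.single_apply, Fin.ext_iff, smul_eq_mul]
  split_ifs <;> first | omega | norm_num
theorem br_YW : bracket n (E n (iY n i)) (E n (iW n hn)) = 0 := by
  rw [bracket_E]; funext k
  have := i.isLt
  have : (iW n hn).val = 2 * n - 1 := rfl
  have : (iY n i).val = i.val + 1 := rfl
  simp only [structC, E, Pi.smul_apply, Pi.zero_apply, Pi.single_apply, Fin.ext_iff, smul_eq_mul]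
  split_ifs <;> first | omega | norm_num
theorem br_ZW : bracket n (E n (iZ n i)) (E n (iW n hn)) = 0 := by
  rw [bracket_E]; funext k
  have := i.isLt
  have : (iW n hn).val = 2 * n - 1 := rfl
  have : (iZ n i).val = i.val + n := rfl
  simp only [structC, E, Pi.smul_apply, Pi.zero_apply, Pi.single_apply, Fin.ext_iff, smul_eq_mul]
  split_ifs <;> first | omega | norm_num
theorem br_WW : bracket n (E n (iW n hn)) (E n (iW n hn)) = 0 := by
  rw [bracket_E]; funext k
  have : (iW n hn).val = 2 * n - 1 := rfl
  simp only [structC, E, Pi.smul_apply, Pi.zero_apply, Pi.single_apply, Fin.ext_iff, smul_eq_mul]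
  split_ifs <;> first | omega | norm_num
theorem br_YX : bracket n (E n (iY n i)) (E n (iX n hn)) = (-(1 / 2) : ℝ) • E n (iY n i) := by
  rw [br_anti, br_XY n hn]; simp
theorem br_ZX : bracket n (E n (iZ n i)) (E n (iX n hn)) = (-(1 / 2) : ℝ) • E n (iZ n i) := by
  rw [br_anti, br_XZ n hn]; simp
theorem br_WX : bracket n (E n (iW n hn)) (E n (iX n hn)) = (-1 : ℝ) • E n (iW n hn) := by
  rw [br_anti, br_XW n hn]; simp
theorem br_YZ : bracket n (E n (iY n i)) (E n (iZ n j))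
    = (if i = j then (-1 : ℝ) else 0) • E n (iW n hn) := by
  rw [br_anti, br_ZY n hn]; split_ifs <;> simp
theorem br_WY : bracket n (E n (iW n hn)) (E n (iY n i)) = 0 := by
  rw [br_anti, br_YW n hn]; simp
theorem br_WZ : bracket n (E n (iW n hn)) (E n (iZ n i)) = 0 := by
  rw [br_anti, br_ZW n hn]; simp
end br

section ipl
variable (n : ℕ) (S : Matrix (Fin (2 * n)) (Fin (2 * n)) ℝ) (u v w : Fin (2 * n) → ℝ) (c : ℝ)
theorem ip_add_l : ip n S (u + v) w = ip n S u w + ip n S v w := by simp [ip, add_dotProduct]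
theorem ip_sub_l : ip n S (u - v) w = ip n S u w - ip n S v w := by simp [ip, sub_dotProduct]
theorem ip_smul_l : ip n S (c • u) w = c * ip n S u w := by simp [ip, smul_dotProduct]
theorem ip_neg_l : ip n S (-u) w = - ip n S u w := by simp [ip, neg_dotProduct]
theorem ip_zero_l : ip n S 0 w = 0 := by simp [ip]
theorem ip_sum_l {ι : Type} [Fintype ι] (f : ι → Fin (2 * n) → ℝ) :
    ip n S (∑ k, f k) w = ∑ k, ip n S (f k) w := by simp [ip, sum_dotProduct]
theorem ip_E (a b : Fin (2 * n)) : ip n S (E n a) (E n b) = S a b := by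
  simp [ip, E]
end ipl

section sv
variable (n : ℕ) (hn : 2 ≤ n) (p β : ℝ) (x σ : Fin (n - 1) → ℝ) (i j : Fin (n - 1))

theorem S_symm (a b : Fin (2 * n)) : Sform n p x σ β a b = Sform n p x σ β b a := by
  by_cases h : a = b
  · rw [h]
  · have h2 : a.val ≠ b.val := fun e => h (Fin.ext e)
    simp only [Sform, Fin.ext_iff]
    split_ifs <;> first | rfl | omega

theorem S_XX : Sform n p x σ β (iX n hn) (iX n hn) = p := by
  have : (iX n hn).val = 0 := rfl
  simp only [Sform, Fin.ext_iff]
  split_ifs <;> first | omega | rfl | (simp [iZ]; done) | (exfalso; simp_all; done)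
theorem S_XY : Sform n p x σ β (iX n hn) (iY n i) = x i := by
  have := i.isLt
  have : (iX n hn).val = 0 := rfl
  have : (iY n i).val = i.val + 1 := rfl
  simp only [Sform, Fin.ext_iff]
  split_ifs <;> first | omega | rfl | (simp [iZ]; done) | (exfalso; simp_all; done)
theorem S_XZ : Sform n p x σ β (iX n hn) (iZ n i) = 0 := by
  have := i.isLt
  have : (iX n hn).val = 0 := rfl
  have : (iZ n i).val = i.val + n := rfl
  simp only [Sform, Fin.ext_iff]
  split_ifs <;> first | omega | rfl | (simp [iZ]; done) | (exfalso; simp_all; done)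
theorem S_XW : Sform n p x σ β (iX n hn) (iW n hn) = 0 := by
  have : (iW n hn).val = 2 * n - 1 := rfl
  have : (iX n hn).val = 0 := rfl
  simp only [Sform, Fin.ext_iff]
  split_ifs <;> first | omega | rfl | (simp [iZ]; done) | (exfalso; simp_all; done)
theorem S_YY : Sform n p x σ β (iY n i) (iY n j) = if i = j then σ i else 0 := by
  have := i.isLt
  have := j.isLt
  have : (iY n i).val = i.val + 1 := rfl
  have : (iY n j).val = j.val + 1 := rfl
  simp only [Sform, Fin.ext_iff]
  split_ifs <;> first | omega | rfl | (simp [iZ]; done) | (exfalso; simp_all; done)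
theorem S_YZ : Sform n p x σ β (iY n i) (iZ n j) = 0 := by
  have := i.isLt
  have := j.isLt
  have : (iY n i).val = i.val + 1 := rfl
  have : (iZ n j).val = j.val + n := rfl
  simp only [Sform, Fin.ext_iff]
  split_ifs <;> first | omega | rfl | (simp [iZ]; done) | (exfalso; simp_all; done)
theorem S_YW : Sform n p x σ β (iY n i) (iW n hn) = 0 := by
  have := i.isLt
  have : (iW n hn).val = 2 * n - 1 := rfl
  have : (iY n i).val = i.val + 1 := rfl
  simp only [Sform, Fin.ext_iff]
  split_ifs <;> first | omega | rfl | (simp [iZ]; done) | (exfalso; simp_all; done)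
theorem S_ZZ : Sform n p x σ β (iZ n i) (iZ n j) = if i = j then σ i else 0 := by
  have := i.isLt
  have := j.isLt
  have : (iZ n i).val = i.val + n := rfl
  have : (iZ n j).val = j.val + n := rfl
  simp only [Sform, Fin.ext_iff]
  split_ifs <;> first | omega | rfl | (simp [iZ]; done) | (exfalso; simp_all; done)
theorem S_ZW : Sform n p x σ β (iZ n i) (iW n hn) = 0 := by
  have := i.isLt
  have : (iW n hn).val = 2 * n - 1 := rfl
  have : (iZ n i).val = i.val + n := rfl
  simp only [Sform, Fin.ext_iff]
  split_ifs <;> first | omega | rfl | (simp [iZ]; done) | (exfalso; simp_all; done)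
theorem S_WW : Sform n p x σ β (iW n hn) (iW n hn) = β := by
  have : (iW n hn).val = 2 * n - 1 := rfl
  simp only [Sform, Fin.ext_iff]
  split_ifs <;> first | omega | rfl | (simp [iZ]; done) | (exfalso; simp_all; done)

theorem S_YX : Sform n p x σ β (iY n i) (iX n hn) = x i := by rw [S_symm, S_XY]
theorem S_ZX : Sform n p x σ β (iZ n i) (iX n hn) = 0 := by rw [S_symm, S_XZ]
theorem S_WX : Sform n p x σ β (iW n hn) (iX n hn) = 0 := by rw [S_symm, S_XW]
theorem S_ZY : Sform n p x σ β (iZ n i) (iY n j) = 0 := by rw [S_symm, S_YZ]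
theorem S_WY : Sform n p x σ β (iW n hn) (iY n i) = 0 := by rw [S_symm, S_YW]
theorem S_WZ : Sform n p x σ β (iW n hn) (iZ n i) = 0 := by rw [S_symm, S_ZW]

/-- The vector `X - Σ (x_k/σ_k) Y_k`. -/
def fv : Fin (2 * n) → ℝ := E n (iX n hn) - ∑ k, (x k / σ k) • E n (iY n k)

theorem fv_X : ip n (Sform n p x σ β) (fv n hn x σ) (E n (iX n hn)) = zval n p x σ := by
  simp only [fv, ip_sub_l, ip_sum_l, ip_smul_l, ip_E, S_XX, S_YX, zval]
  congr 1
  exact Finset.sum_congr rfl fun k _ => by ring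
theorem fv_Y (hσ : ∀ i, 1 ≤ σ i) :
    ip n (Sform n p x σ β) (fv n hn x σ) (E n (iY n i)) = 0 := by
  have := hσ i
  have h0 : σ i ≠ 0 := by linarith
  simp [fv, ip_sub_l, ip_sum_l, ip_smul_l, ip_E, S_XY, S_YY, h0]
theorem fv_Z : ip n (Sform n p x σ β) (fv n hn x σ) (E n (iZ n i)) = 0 := by
  simp [fv, ip_sub_l, ip_sum_l, ip_smul_l, ip_E, S_XZ, S_YZ]
theorem fv_W : ip n (Sform n p x σ β) (fv n hn x σ) (E n (iW n hn)) = 0 := by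
  simp [fv, ip_sub_l, ip_sum_l, ip_smul_l, ip_E, S_XW, S_YW]

theorem ip_E_r (v : Fin (2 * n) → ℝ) (t : Fin (2 * n)) :
    ip n (Sform n p x σ β) v (E n t) = (Sform n p x σ β *ᵥ v) t := by
  simp only [ip, E, mulVec, dotProduct]
  refine Finset.sum_congr rfl fun k _ => ?_
  rw [S_symm n p β x σ t k, mul_comm]
  congr 1
  simp [Pi.single_apply]

theorem E_ne {a b : Fin (2 * n)} (h : a.val ≠ b.val) : E n a b = 0 := by
  simp only [E, Pi.single_apply]
  rw [if_neg (fun e => h (by rw [e]))]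

theorem S_unit (hn : 2 ≤ n) (hβ : 0 < β) (hσ : ∀ i, 1 ≤ σ i) (hz : 0 < zval n p x σ) :
    IsUnit (Sform n p x σ β).det := by
  have hz' := hz.ne'
  have hσ' : ∀ i, σ i ≠ 0 := fun i => by have := hσ i; linarith
  have hβ' := hβ.ne'
  have key : ∀ t, ∃ b, Sform n p x σ β *ᵥ b = E n t := by
    have red : ∀ t b, (∀ s, ip n (Sform n p x σ β) b (E n s) = E n t s) →
        Sform n p x σ β *ᵥ b = E n t := fun t b h => by
      funext s; rw [← ip_E_r, h]
    intro t
    rcases idx_cases n hn t with rfl | ⟨i, rfl⟩ | ⟨i, rfl⟩ | rfl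
    · refine ⟨(zval n p x σ)⁻¹ • fv n hn x σ, red _ _ fun s => ?_⟩
      rcases idx_cases n hn s with rfl | ⟨k, rfl⟩ | ⟨k, rfl⟩ | rfl
      · rw [ip_smul_l, fv_X, inv_mul_cancel₀ hz']; simp [E]
      · simp [ip_smul_l, fv_Y, hσ]; rw [E_ne]; simp [iX, iY]
      · simp [ip_smul_l, fv_Z]; rw [E_ne]; simp [iX, iZ]; omega
      · simp [ip_smul_l, fv_W]; rw [E_ne]; simp [iX, iW]; omega
    · refine ⟨(σ i)⁻¹ • (E n (iY n i) - (x i / zval n p x σ) • fv n hn x σ),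
        red _ _ fun s => ?_⟩
      have := i.isLt
      rcases idx_cases n hn s with rfl | ⟨k, rfl⟩ | ⟨k, rfl⟩ | rfl
      · simp [ip_smul_l, ip_sub_l, fv_X, ip_E, S_YX, hz']; rw [E_ne]; simp [iX, iY]
      · simp [ip_smul_l, ip_sub_l, fv_Y, ip_E, S_YY, hσ]
        by_cases h : i = k
        · subst h; simp [E, hσ']
        · rw [E_ne]; simp [h]
          simp [iY, ← Fin.ext_iff, h]
      · simp [ip_smul_l, ip_sub_l, fv_Z, ip_E, S_YZ]; rw [E_ne]; simp [iY, iZ]; omega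
      · simp [ip_smul_l, ip_sub_l, fv_W, ip_E, S_YW]; rw [E_ne]; simp [iY, iW]; omega
    · refine ⟨(σ i)⁻¹ • E n (iZ n i), red _ _ fun s => ?_⟩
      have := i.isLt
      rcases idx_cases n hn s with rfl | ⟨k, rfl⟩ | ⟨k, rfl⟩ | rfl
      · simp [ip_smul_l, ip_E, S_ZX]; rw [E_ne]; simp [iX, iZ]; omega
      · simp [ip_smul_l, ip_E, S_ZY]; rw [E_ne]; have := k.isLt; simp [iY, iZ]; omega
      · simp [ip_smul_l, ip_E, S_ZZ]
        by_cases h : i = k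
        · subst h; simp [E, hσ']
        · rw [E_ne]; simp [h]
          simp [iZ, ← Fin.ext_iff, h]
      · simp [ip_smul_l, ip_E, S_ZW]; rw [E_ne]; simp [iZ, iW]; omega
    · refine ⟨β⁻¹ • E n (iW n hn), red _ _ fun s => ?_⟩
      rcases idx_cases n hn s with rfl | ⟨k, rfl⟩ | ⟨k, rfl⟩ | rfl
      · simp [ip_smul_l, ip_E, S_WX]; rw [E_ne]; simp [iX, iW]; omega
      · simp [ip_smul_l, ip_E, S_WY]; rw [E_ne]; have := k.isLt; simp [iY, iW]; omega
      · simp [ip_smul_l, ip_E, S_WZ]; rw [E_ne]; have := k.isLt; simp [iZ, iW]; omega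
      · rw [ip_smul_l, ip_E, S_WW, inv_mul_cancel₀ hβ']; simp [E]
  choose b hb using key
  refine Matrix.isUnit_det_of_right_inverse (B := Matrix.of fun s t => b t s) ?_
  ext s t
  have := congrFun (hb t) s
  simp only [mulVec, dotProduct] at this
  rw [Matrix.mul_apply]
  simp only [Matrix.of_apply]
  rw [this]
  simp [E, Pi.single_apply, Matrix.one_apply]

theorem nabla_eq (hn : 2 ≤ n) (hβ : 0 < β) (hσ : ∀ i, 1 ≤ σ i) (hz : 0 < zval n p x σ)
    (u v w : Fin (2 * n) → ℝ)
    (h : ∀ t, 2 * ip n (Sform n p x σ β) w (E n t)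
      = ip n (Sform n p x σ β) (bracket n u v) (E n t)
        - ip n (Sform n p x σ β) (bracket n v (E n t)) u
        + ip n (Sform n p x σ β) (bracket n (E n t) u) v) :
    nabla n (Sform n p x σ β) u v = w := by
  have hk : koszul n (Sform n p x σ β) u v = (2 : ℝ) • (Sform n p x σ β *ᵥ w) := by
    funext t
    have := h t
    rw [ip_E_r n p β x σ w t] at this
    simp only [Pi.smul_apply, smul_eq_mul]
    rw [this]
    rfl
  have hu := S_unit n p β x σ hn hβ hσ hz
  rw [nabla, hk, mulVec_smul, mulVec_mulVec, Matrix.nonsing_inv_mul _ hu, one_mulVec, smul_smul]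
  norm_num
end sv

/-- The nonzero covariant derivatives of the Levi-Civita connection of
`g(p,x,σ,β)` on the basis vectors, together with `∇_X Z_i = ∇_X W = 0`. -/
theorem levi_civita_table (n : ℕ) (hn : 2 ≤ n) (p β : ℝ) (x σ : Fin (n - 1) → ℝ)
    (hadm : Admissible n p x σ β) (hz : 0 < zval n p x σ) :
    let S := Sform n p x σ β
    let z := zval n p x σ
    let X : Fin (2 * n) → ℝ := Pi.single ⟨0, by omega⟩ 1
    let Y : Fin (n - 1) → Fin (2 * n) → ℝ :=
      fun i => Pi.single ⟨i.val + 1, by have := i.isLt; omega⟩ 1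
    let Z : Fin (n - 1) → Fin (2 * n) → ℝ :=
      fun i => Pi.single ⟨i.val + n, by have := i.isLt; omega⟩ 1
    let W : Fin (2 * n) → ℝ := Pi.single ⟨2 * n - 1, by omega⟩ 1
    (nabla n S X X
      = (1 / (2 * z)) • ((∑ i, (x i) ^ 2 / σ i) • X - p • ∑ i, (x i / σ i) • Y i)) ∧
    (∀ i, nabla n S X (Y i)
      = (x i / (2 * z)) • (X - ∑ k, (x k / σ k) • Y k)) ∧
    (∀ i, nabla n S (Y i) X
      = (x i / (2 * z)) • (X - ∑ k, (x k / σ k) • Y k) - ((1 : ℝ) / 2) • Y i) ∧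
    (∀ i j, nabla n S (Y i) (Y j)
      = (((if i = j then σ i else 0)) / (2 * z)) • (X - ∑ k, (x k / σ k) • Y k)) ∧
    (∀ i j, nabla n S (Y i) (Z j)
      = (-((if i = j then (1 : ℝ) else 0) / 2)) • W) ∧
    (∀ i j, nabla n S (Z j) (Y i)
      = ((if i = j then (1 : ℝ) else 0) / 2) • W) ∧
    (∀ i, nabla n S (Y i) W = (β / (2 * σ i)) • Z i) ∧
    (∀ i, nabla n S W (Y i) = (β / (2 * σ i)) • Z i) ∧
    (∀ i, nabla n S (Z i) X = (-((1 : ℝ) / 2)) • Z i) ∧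
    (∀ i j, nabla n S (Z i) (Z j)
      = (((if i = j then σ i else 0)) / (2 * z)) • (X - ∑ k, (x k / σ k) • Y k)) ∧
    (nabla n S W W = (β / z) • (X - ∑ i, (x i / σ i) • Y i)) ∧
    (nabla n S W X = -W) ∧
    (∀ i, nabla n S W (Z i)
      = (β / (2 * z * σ i)) • (x i • X - x i • ∑ k, (x k / σ k) • Y k - z • Y i)) ∧
    (∀ i, nabla n S (Z i) W
      = (β / (2 * z * σ i)) • (x i • X - x i • ∑ k, (x k / σ k) • Y k - z • Y i)) ∧
    (∀ i, nabla n S X (Z i) = 0) ∧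
    (nabla n S X W = 0) := by
  obtain ⟨hp, hβ, hx, -, hσ, -⟩ := hadm
  have hσ' : ∀ i, σ i ≠ 0 := fun i => by have := hσ i; linarith
  intro S z X Y Z W
  have hX : X = E n (iX n hn) := rfl
  have hY : ∀ i, Y i = E n (iY n i) := fun _ => rfl
  have hZ : ∀ i, Z i = E n (iZ n i) := fun _ => rfl
  have hW : W = E n (iW n hn) := rfl
  have hf : X - ∑ k, (x k / σ k) • Y k = fv n hn x σ := rfl
  have hf2 : ∑ k, (x k / σ k) • Y k = X - fv n hn x σ := by rw [← hf]; abel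
  have hzp : ∑ i, (x i) ^ 2 / σ i = p - z := by simp only [z, zval]; ring
  have hzz : z ≠ 0 := hz.ne'
  have hfX : ip n (Sform n p x σ β) (fv n hn x σ) (E n (iX n hn)) = z := fv_X n hn p β x σ
  have hfY := fun i => fv_Y n hn p β x σ i hσ
  have key := nabla_eq n p β x σ hn hβ hσ hz
  simp only [hzp, hf2, sub_sub_cancel]
  clear hf hf2 hzp
  clear_value z X Y Z W
  subst hX hW
  obtain rfl : Y = fun i => E n (iY n i) := funext hY
  obtain rfl : Z = fun i => E n (iZ n i) := funext hZ
  clear hY hZ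
  refine ⟨?_, fun i => ?_, fun i => ?_, fun i j => ?_, fun i j => ?_, fun i j => ?_, fun i => ?_,
    fun i => ?_, fun i => ?_, fun i j => ?_, ?_, ?_, fun i => ?_, fun i => ?_, fun i => ?_, ?_⟩
  all_goals
    refine key _ _ _ fun t => ?_
    rcases idx_cases n hn t with rfl | ⟨k, rfl⟩ | ⟨k, rfl⟩ | rfl
  all_goals
    simp only [br_XX, br_XY, br_XZ, br_XW, br_YX, br_YY, br_YZ n hn, br_YW, br_ZX, br_ZY n hn,
      br_ZZ, br_ZW, br_WX, br_WY, br_WZ, br_WW, ip_sub_l, ip_smul_l, ip_neg_l, ip_zero_l,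
      hfX, hfY, fv_Z, fv_W, ip_E, S_XX, S_XY, S_XZ, S_XW, S_YX, S_YY, S_YZ, S_YW,
      S_ZX, S_ZY, S_ZZ, S_ZW, S_WX, S_WY, S_WZ, S_WW]
  all_goals
    try have hi := hσ' i
    first
    | (field_simp; ring1)
    | (field_simp; done)
    | (split_ifs <;> subst_vars <;>
        first | contradiction | (field_simp; done) | (field_simp; ring1) | (exfalso; grind))

end CHn
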